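/- arXiv:2007.06264 — 2 statements merged into one kernel-verified Lean document; each statement's English description precedes it below -/
import Mathlib

section
/- Let q ∈ (0,1), ζ₊ > 0, ζ₋ < 0. Suppose c = conj(d) ∈ ℂ∖ℝ and that a, b are real numbers which either both lie in an interval (ζ₊^{−1}q^{m+1}, ζ₊^{−1}q^m) for some m ∈ ℤ, or both lie in an interval (ζ₋^{−1}q^m, ζ₋^{−1}q^{m+1}) for some m ∈ ℤ, and assume ab < cd·q (where cd = |c|²). Then W(x; q; a,b,c,d) > 0 for every x ∈ Λ, and the family (W(x; q; a,b,c,d))_{x∈Λ} is summable. -/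
/-- The infinite q-Pochhammer symbol `(u; q)_∞ = ∏_{n=0}^∞ (1 - u qⁿ)`. -/
noncomputable def qPochC (q : ℝ) (u : ℂ) : ℂ := ∏' n : ℕ, (1 - u * (q : ℂ) ^ n)

/-- The two-sided q-lattice `Λ = ζ₊ q^ℤ ∪ ζ₋ q^ℤ`. -/
def Lambda (q ζp ζm : ℝ) : Set ℝ := {x | ∃ n : ℤ, x = ζp * q ^ n ∨ x = ζm * q ^ n}

/-- The weight function `W(x; q; a,b,c,d) = (1-q)|x| (ax;q)_∞(bx;q)_∞ / ((cx;q)_∞(dx;q)_∞)`. -/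
noncomputable def Wc (q : ℝ) (a b c d : ℂ) (x : ℝ) : ℂ :=
  (((1 - q) * |x| : ℝ) : ℂ) * (qPochC q (a * x) * qPochC q (b * x)) /
    (qPochC q (c * x) * qPochC q (d * x))

open Filter Topology ComplexOrder

lemma summable_norm_qPochC_factor {q : ℝ} (hq0 : 0 < q) (hq1 : q < 1) (u : ℂ) :
    Summable fun n : ℕ ↦ ‖-(u * (q : ℂ) ^ n)‖ := by
  simp only [norm_neg, norm_mul, norm_pow, Complex.norm_real, Real.norm_of_nonneg hq0.le]
  exact (summable_geometric_of_lt_one hq0.le hq1).mul_left _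

lemma multipliable_qPochC_factor {q : ℝ} (hq0 : 0 < q) (hq1 : q < 1) (u : ℂ) :
    Multipliable fun n : ℕ ↦ 1 - u * (q : ℂ) ^ n := by
  simpa only [sub_eq_add_neg] using
    multipliable_one_add_of_summable (summable_norm_qPochC_factor hq0 hq1 u)

lemma qPochC_ne_zero {q : ℝ} (hq0 : 0 < q) (hq1 : q < 1) {u : ℂ}
    (hu : ∀ n : ℕ, 1 - u * (q : ℂ) ^ n ≠ 0) : qPochC q u ≠ 0 := by
  simp only [sub_eq_add_neg] at hu
  simpa only [qPochC, sub_eq_add_neg] using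
    tprod_one_add_ne_zero_of_summable hu (summable_norm_qPochC_factor hq0 hq1 u)

lemma qPochC_eq_mul {q : ℝ} (hq0 : 0 < q) (hq1 : q < 1) (u : ℂ) :
    qPochC q u = (1 - u) * qPochC q (u * q) := by
  have hshift (n : ℕ) : 1 - u * q * (q : ℂ) ^ n = 1 - u * (q : ℂ) ^ (n + 1) := by ring
  have hm := (multipliable_qPochC_factor hq0 hq1 (u * q)).congr hshift
  have hsplit := tprod_eq_zero_mul' (f := fun n : ℕ ↦ 1 - u * (q : ℂ) ^ n) hm
  simp only [qPochC, hshift]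
  rwa [pow_zero, mul_one] at hsplit

lemma qPochC_mul_pos {q : ℝ} (hq0 : 0 < q) (hq1 : q < 1) {u v : ℂ}
    (huv : ∀ n : ℕ, 0 < (1 - u * (q : ℂ) ^ n) * (1 - v * (q : ℂ) ^ n)) :
    0 < qPochC q u * qPochC q v := by
  have hne := mul_ne_zero
    (qPochC_ne_zero hq0 hq1 fun n ↦ left_ne_zero_of_mul (huv n).ne')
    (qPochC_ne_zero hq0 hq1 fun n ↦ right_ne_zero_of_mul (huv n).ne')
  have hprod := (multipliable_qPochC_factor hq0 hq1 u).hasProd.mul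
    (multipliable_qPochC_factor hq0 hq1 v).hasProd
  refine lt_of_le_of_ne (ge_of_tendsto' hprod fun s ↦ ?_) hne.symm
  exact Finset.prod_nonneg fun n _ ↦ (huv n).le

lemma one_sub_mul_ofReal_ne_zero {c : ℂ} (hc : c.im ≠ 0) (x : ℝ) : 1 - c * x ≠ 0 := by
  intro h0
  have him := congrArg Complex.im h0
  have hre := congrArg Complex.re h0
  simp [hc] at him hre
  simp [him] at hre

lemma Wc_pos {q : ℝ} (hq0 : 0 < q) (hq1 : q < 1) {a b : ℝ} {c d : ℂ}
    (hcd : c = (starRingEnd ℂ) d) (hc : c.im ≠ 0) {x : ℝ} (hx : x ≠ 0)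
    (hab : ∀ n : ℕ, 0 < (1 - a * x * q ^ n) * (1 - b * x * q ^ n)) :
    0 < Wc q a b c d x := by
  have hnum : 0 < qPochC q (a * x) * qPochC q (b * x) :=
    qPochC_mul_pos hq0 hq1 fun n ↦ by exact_mod_cast hab n
  have hden : 0 < qPochC q (c * x) * qPochC q (d * x) := by
    refine qPochC_mul_pos hq0 hq1 fun n ↦ ?_
    have hconj : 1 - c * x * (q : ℂ) ^ n = (starRingEnd ℂ) (1 - d * x * (q : ℂ) ^ n) := by
      simp [hcd]
    have hne : 1 - d * x * (q : ℂ) ^ n ≠ 0 := by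
      have hd : d.im ≠ 0 := by simpa [hcd] using hc
      simpa [mul_assoc] using one_sub_mul_ofReal_ne_zero hd (x * q ^ n)
    rw [hconj, mul_comm, Complex.mul_conj]
    exact_mod_cast Complex.normSq_pos.mpr hne
  have hfac : (0 : ℂ) < (((1 - q) * |x| : ℝ) : ℂ) := by
    exact_mod_cast mul_pos (sub_pos.mpr hq1) (abs_pos.mpr hx)
  exact div_pos (mul_pos hfac hnum) hden

lemma Wc_eq_mul {q : ℝ} (hq0 : 0 < q) (hq1 : q < 1) (a b c d : ℂ) (x : ℝ) :
    Wc q a b c d x = Wc q a b c d (x * q) *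
      ((1 - a * x) * (1 - b * x) / (q * ((1 - c * x) * (1 - d * x)))) := by
  have hq : (q : ℂ) ≠ 0 := by exact_mod_cast hq0.ne'
  have hshift (u : ℂ) : qPochC q (u * x) = (1 - u * x) * qPochC q (u * (x * q : ℝ)) := by
    rw [qPochC_eq_mul hq0 hq1, Complex.ofReal_mul, mul_assoc u]
  simp only [Wc, hshift, abs_mul, abs_of_pos hq0]
  push_cast
  rw [div_mul_div_comm, ← mul_div_mul_left _ _ hq]
  congr 1 <;> ring

lemma summable_Wc_zpow {q : ℝ} (hq0 : 0 < q) (hq1 : q < 1) {a b c d : ℂ} {ζ : ℝ} (hζ : ζ ≠ 0)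
    (hc : c ≠ 0) (hd : d ≠ 0) (hlt : ‖a * b‖ < ‖c * d‖ * q)
    (hne : ∀ n : ℤ, Wc q a b c d (ζ * q ^ n) ≠ 0) :
    Summable fun n : ℤ ↦ Wc q a b c d (ζ * q ^ n) := by
  set R : ℂ → ℂ := fun x ↦ (1 - a * x) * (1 - b * x) / (q * ((1 - c * x) * (1 - d * x))) with hR
  have hstep (n : ℤ) : ‖Wc q a b c d (ζ * q ^ n)‖ =
      ‖Wc q a b c d (ζ * q ^ (n + 1))‖ * ‖R ((ζ * q ^ n : ℝ) : ℂ)‖ := by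
    rw [← norm_mul, zpow_add_one₀ hq0.ne', ← mul_assoc, hR, ← Wc_eq_mul hq0 hq1]
  have hpow (r : ℝ) : Tendsto (fun n : ℕ ↦ ((r * q ^ n : ℝ) : ℂ)) atTop (𝓝 0) := by
    have h := (tendsto_pow_atTop_nhds_zero_of_lt_one hq0.le hq1).const_mul r
    rw [mul_zero] at h
    exact_mod_cast (Complex.continuous_ofReal.tendsto 0).comp h
  refine Summable.of_nat_of_neg_add_one ?_ ?_
  · refine summable_of_ratio_test_tendsto_lt_one hq1 (.of_forall fun n ↦ hne n) ?_
    have hlim : Tendsto R (𝓝 0) (𝓝 (q : ℂ)⁻¹) := by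
      have hcont : ContinuousAt R 0 := by
        refine ContinuousAt.div (by fun_prop) (by fun_prop) ?_
        simpa using hq0.ne'
      simpa [hR, ContinuousAt] using hcont
    have hinv := ((hlim.comp (hpow ζ)).norm).inv₀ (by simpa using hq0.ne')
    simp only [norm_inv, inv_inv, Complex.norm_real, Real.norm_of_nonneg hq0.le] at hinv
    refine hinv.congr fun n ↦ ?_
    have h := hstep n
    have hn' := norm_ne_zero_iff.mpr (hne (n + 1))
    rw [zpow_natCast] at h
    rw [Nat.cast_succ, zpow_natCast, h, Function.comp_apply, div_mul_eq_div_div, div_self hn', one_div]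
  · have hcd : 0 < ‖c * d‖ * q := mul_pos (norm_pos_iff.mpr (mul_ne_zero hc hd)) hq0
    refine summable_of_ratio_test_tendsto_lt_one (l := ‖a * b‖ / (‖c * d‖ * q))
      ((div_lt_one hcd).mpr hlt) (.of_forall fun n ↦ hne _) ?_
    set S : ℂ → ℂ := fun t ↦ (t - a) * (t - b) / (q * ((t - c) * (t - d))) with hS
    have hlim : Tendsto S (𝓝 0) (𝓝 (a * b / (q * (c * d)))) := by
      have hcont : ContinuousAt S 0 := by
        refine ContinuousAt.div (by fun_prop) (by fun_prop) ?_
        simp [hc, hd, hq0.ne']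
      simpa [hS, ContinuousAt] using hcont
    have hnorm := (hlim.comp (hpow (ζ⁻¹ * q ^ 2))).norm
    rw [norm_div, norm_mul (q : ℂ), Complex.norm_real, Real.norm_of_nonneg hq0.le,
      mul_comm q] at hnorm
    refine hnorm.congr fun n ↦ ?_
    have hRS (x : ℂ) (hx : x ≠ 0) : S x⁻¹ = R x := by
      simp only [hS, hR]
      rw [← mul_div_mul_left _ _ (pow_ne_zero 2 hx)]
      congr 1 <;> field_simp
    have hx : ((ζ⁻¹ * q ^ 2 * q ^ n : ℝ) : ℂ) =
        ((ζ * q ^ (-(((n + 1 : ℕ) : ℤ) + 1)) : ℝ) : ℂ)⁻¹ := by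
      rw [← Complex.ofReal_inv, mul_inv, zpow_neg, inv_inv, mul_assoc, ← pow_add]
      congr 2
      norm_cast
      congr 1
      ring
    have h := hstep (-(((n + 1 : ℕ) : ℤ) + 1))
    rw [Function.comp_apply, hx, hRS _ (by
      exact_mod_cast mul_ne_zero hζ (zpow_ne_zero _ hq0.ne')), h,
      show -(((n + 1 : ℕ) : ℤ) + 1) + 1 = -((n : ℤ) + 1) by push_cast; ring,
      mul_div_cancel_left₀ _ (norm_ne_zero_iff.mpr (hne _))]

lemma one_sub_mul_one_sub_pos_of_mem_Ioo {q : ℝ} (hq0 : 0 < q) (hq1 : q < 1) {s t : ℝ} {m : ℤ}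
    (hs : s ∈ Set.Ioo (q ^ (m + 1)) (q ^ m)) (ht : t ∈ Set.Ioo (q ^ (m + 1)) (q ^ m)) (j : ℤ) :
    0 < (1 - s * q ^ j) * (1 - t * q ^ j) := by
  have hj : 0 < q ^ j := zpow_pos hq0 j
  rcases le_or_gt 0 (m + j) with hmj | hmj
  · have hle : q ^ m * q ^ j ≤ 1 := by
      rw [← zpow_add₀ hq0.ne']
      exact zpow_le_one₀ hq0 hq1.le hmj
    have key {r : ℝ} (hr : r < q ^ m) : 0 < 1 - r * q ^ j :=
      sub_pos.mpr ((mul_lt_mul_of_pos_right hr hj).trans_le hle)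
    exact mul_pos (key hs.2) (key ht.2)
  · have hle : 1 ≤ q ^ (m + 1) * q ^ j := by
      rw [← zpow_add₀ hq0.ne']
      exact one_le_zpow_of_nonpos₀ hq0 hq1.le (by omega)
    have key {r : ℝ} (hr : q ^ (m + 1) < r) : 1 - r * q ^ j < 0 :=
      sub_neg.mpr (hle.trans_lt (mul_lt_mul_of_pos_right hr hj))
    exact mul_pos_of_neg_of_neg (key hs.1) (key ht.1)

lemma factors_pos_of_mem_Ioo {q : ℝ} (hq0 : 0 < q) (hq1 : q < 1) {ζ ζ' a b : ℝ} {m : ℤ}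
    (hζ : ζ ≠ 0) (hζζ' : ζ' / ζ < 0)
    (ha : a * ζ ∈ Set.Ioo (q ^ (m + 1)) (q ^ m)) (hb : b * ζ ∈ Set.Ioo (q ^ (m + 1)) (q ^ m)) :
    0 < a * b ∧ ∀ j : ℤ, 0 < (1 - a * (ζ * q ^ j)) * (1 - b * (ζ * q ^ j)) ∧
      0 < (1 - a * (ζ' * q ^ j)) * (1 - b * (ζ' * q ^ j)) := by
  have hm := zpow_pos hq0 (m + 1)
  refine ⟨?_, fun j ↦ ⟨?_, ?_⟩⟩
  · have h := mul_pos (hm.trans ha.1) (hm.trans hb.1)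
    rw [mul_mul_mul_comm] at h
    exact pos_of_mul_pos_left h (mul_self_nonneg ζ)
  · simpa only [mul_assoc] using one_sub_mul_one_sub_pos_of_mem_Ioo hq0 hq1 ha hb j
  · have key {r : ℝ} (hr : q ^ (m + 1) < r * ζ) : 0 < 1 - r * (ζ' * q ^ j) := by
      have hneg := mul_neg_of_pos_of_neg (hm.trans hr) hζζ'
      rw [mul_assoc, mul_div_cancel₀ _ hζ] at hneg
      have := mul_neg_of_neg_of_pos hneg (zpow_pos hq0 j)
      linarith
    exact mul_pos (key ha.1) (key hb.1)

/-- Complementary series (N = 1): for `c = conj d ∈ ℂ∖ℝ` and real `a, b` both lying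
inside an interval `(ζ₊⁻¹ q^{m+1}, ζ₊⁻¹ q^m)` or both inside `(ζ₋⁻¹ q^m, ζ₋⁻¹ q^{m+1})`,
with `ab < cd·q` (where `cd = |c|²`), the weights `W(x)` are strictly positive on `Λ`
and summable. -/
theorem stmt3 (q ζp ζm : ℝ) (hq0 : 0 < q) (hq1 : q < 1) (hζp : 0 < ζp) (hζm : ζm < 0)
    (a b : ℝ) (c d : ℂ) (hcd : c = (starRingEnd ℂ) d) (hc : c.im ≠ 0)
    (hint : (∃ m : ℤ, a ∈ Set.Ioo (ζp⁻¹ * q ^ (m + 1)) (ζp⁻¹ * q ^ m) ∧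
                      b ∈ Set.Ioo (ζp⁻¹ * q ^ (m + 1)) (ζp⁻¹ * q ^ m)) ∨
            (∃ m : ℤ, a ∈ Set.Ioo (ζm⁻¹ * q ^ m) (ζm⁻¹ * q ^ (m + 1)) ∧
                      b ∈ Set.Ioo (ζm⁻¹ * q ^ m) (ζm⁻¹ * q ^ (m + 1))))
    (h : a * b < (c * d).re * q) :
    (∀ x ∈ Lambda q ζp ζm,
      0 < (Wc q (a : ℂ) (b : ℂ) c d x).re ∧ (Wc q (a : ℂ) (b : ℂ) c d x).im = 0) ∧
    Summable (fun x : Lambda q ζp ζm => (Wc q (a : ℂ) (b : ℂ) c d (x : ℝ)).re) := by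
  obtain ⟨hab0, hfac⟩ : 0 < a * b ∧
      ∀ j : ℤ, 0 < (1 - a * (ζp * q ^ j)) * (1 - b * (ζp * q ^ j)) ∧
        0 < (1 - a * (ζm * q ^ j)) * (1 - b * (ζm * q ^ j)) := by
    rcases hint with ⟨m, ha, hb⟩ | ⟨m, ha, hb⟩
    · have key {r : ℝ} (hr : r ∈ Set.Ioo (ζp⁻¹ * q ^ (m + 1)) (ζp⁻¹ * q ^ m)) :
          r * ζp ∈ Set.Ioo (q ^ (m + 1)) (q ^ m) := by
        rw [Set.mem_Ioo, inv_mul_lt_iff₀ hζp, lt_inv_mul_iff₀ hζp] at hr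
        rwa [mul_comm]
      exact factors_pos_of_mem_Ioo hq0 hq1 hζp.ne' (div_neg_of_neg_of_pos hζm hζp)
        (key ha) (key hb)
    · have key {r : ℝ} (hr : r ∈ Set.Ioo (ζm⁻¹ * q ^ m) (ζm⁻¹ * q ^ (m + 1))) :
          r * ζm ∈ Set.Ioo (q ^ (m + 1)) (q ^ m) := by
        have h1 := mul_lt_mul_of_neg_right hr.1 hζm
        have h2 := mul_lt_mul_of_neg_right hr.2 hζm
        rw [mul_right_comm, inv_mul_cancel₀ hζm.ne, one_mul] at h1 h2
        exact ⟨h2, h1⟩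
      have := factors_pos_of_mem_Ioo hq0 hq1 hζm.ne (div_neg_of_pos_of_neg hζp hζm)
        (key ha) (key hb)
      exact ⟨this.1, fun j ↦ (this.2 j).symm⟩
  have hshift (r ζ : ℝ) (n : ℤ) (k : ℕ) : r * (ζ * q ^ n) * q ^ k = r * (ζ * q ^ (n + k)) := by
    rw [zpow_add₀ hq0.ne', zpow_natCast]
    ring
  have hposp (n : ℤ) : 0 < Wc q a b c d (ζp * q ^ n) :=
    Wc_pos hq0 hq1 hcd hc (mul_ne_zero hζp.ne' (zpow_ne_zero _ hq0.ne')) fun k ↦ by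
      rw [hshift, hshift]
      exact (hfac _).1
  have hposm (n : ℤ) : 0 < Wc q a b c d (ζm * q ^ n) :=
    Wc_pos hq0 hq1 hcd hc (mul_ne_zero hζm.ne (zpow_ne_zero _ hq0.ne')) fun k ↦ by
      rw [hshift, hshift]
      exact (hfac _).2
  have hc0 : c ≠ 0 := fun h0 ↦ hc (by simp [h0])
  have hd0 : d ≠ 0 := fun h0 ↦ hc0 (by simp [hcd, h0])
  have hlt : ‖(a : ℂ) * b‖ < ‖c * d‖ * q := by
    rw [← Complex.ofReal_mul, Complex.norm_real, Real.norm_of_nonneg hab0.le]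
    exact h.trans_le (mul_le_mul_of_nonneg_right (Complex.re_le_norm _) hq0.le)
  refine ⟨?_, ?_⟩
  · rintro x ⟨n, rfl | rfl⟩
    · exact (Complex.pos_iff.mp (hposp n)).imp_right Eq.symm
    · exact (Complex.pos_iff.mp (hposm n)).imp_right Eq.symm
  · set F : ℤ ⊕ ℤ → ℝ := Sum.elim (fun n ↦ ζp * q ^ n) (fun n ↦ ζm * q ^ n) with hF
    have hsum : Summable fun i ↦ (Wc q a b c d (F i)).re :=
      Summable.sum _
        (Complex.hasSum_re (summable_Wc_zpow hq0 hq1 hζp.ne' hc0 hd0 hlt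
          fun n ↦ (hposp n).ne').hasSum).summable
        (Complex.hasSum_re (summable_Wc_zpow hq0 hq1 hζm.ne hc0 hd0 hlt
          fun n ↦ (hposm n).ne').hasSum).summable
    have hsurj (x : Lambda q ζp ζm) : ∃ i, F i = x := by
      obtain ⟨x, n, rfl | rfl⟩ := x
      · exact ⟨.inl n, rfl⟩
      · exact ⟨.inr n, rfl⟩
    choose g hg using hsurj
    have hinj : Function.Injective g := fun x y hxy ↦ Subtype.ext (by rw [← hg x, ← hg y, hxy])
    refine (hsum.comp_injective hinj).congr fun x ↦ ?_
    rw [Function.comp_apply, hg]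
end

section
/- Let q, t ∈ (0,1), τ := log_q t, ζ₊ > 0, ζ₋ < 0, and N ∈ ℤ_{≥1}. There exists a constant C > 0, depending only on N, q, t, ζ₊, ζ₋ (but not on X), such that V_{q,t}(X) ≤ C · ∏_{x∈X} max(1,|x|)^{2τ(N−1)} for every X ∈ Ω_N. -/
/-- The infinite q-Pochhammer symbol `(u; q)_∞` (real version). -/
noncomputable def qPochR (q u : ℝ) : ℝ := ∏' n : ℕ, (1 - u * q ^ n)

/-- The theta function `θ_q(v) = (v;q)_∞ (q v⁻¹;q)_∞`. -/
noncomputable def thetaQ (q v : ℝ) : ℝ := qPochR q v * qPochR q (q * v⁻¹)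

/-- `ψ_τ(u) = (-u)^{2τ-1} θ_q(tu)/θ_q(t u⁻¹)` with `τ = log_q t`. -/
noncomputable def psiQ (q t u : ℝ) : ℝ :=
  (-u) ^ (2 * Real.logb q t - 1) * thetaQ q (t * u) / thetaQ q (t * u⁻¹)

/-- A (finite or countably infinite) particle configuration: a countable set of nonzero
reals, whose points can be enumerated from the outside toward 0 on each side, whose
outermost positive (resp. negative) point lies on `ζ₊ q^ℤ` (resp. `ζ₋ q^ℤ`), and in which
any two consecutive points of the same sign have ratio in `t q^{ℤ≥0}`. -/
def IsConfig (q t ζp ζm : ℝ) (X : Set ℝ) : Prop :=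
  X.Countable ∧ (0 : ℝ) ∉ X ∧
  (∀ x ∈ X, 0 < x → {y ∈ X | x < y}.Finite) ∧
  (∀ x ∈ X, x < 0 → {y ∈ X | y < x}.Finite) ∧
  (∀ x ∈ X, 0 < x → (∀ y ∈ X, 0 < y → y ≤ x) → ∃ n : ℤ, x = ζp * q ^ n) ∧
  (∀ x ∈ X, x < 0 → (∀ y ∈ X, y < 0 → x ≤ y) → ∃ n : ℤ, x = ζm * q ^ n) ∧
  (∀ x ∈ X, ∀ y ∈ X, 0 < y → y < x → (∀ z ∈ X, z ≤ y ∨ x ≤ z) → ∃ k : ℕ, y = x * t * q ^ k) ∧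
  (∀ x ∈ X, ∀ y ∈ X, y < x → x < 0 → (∀ z ∈ X, z ≤ y ∨ x ≤ z) → ∃ k : ℕ, x = y * t * q ^ k)

/-- The set `Ω_N` of N-particle configurations, realized as finsets of reals. -/
def OmegaN (q t ζp ζm : ℝ) (N : ℕ) : Set (Finset ℝ) :=
  {X | X.card = N ∧ IsConfig q t ζp ζm ↑X}

/-- The (q,t)-interaction `V_{q,t}(X)`. -/
noncomputable def Vqt (q t : ℝ) (X : Finset ℝ) : ℝ :=
  (∏ x ∈ X, ∏ y ∈ X, if y < x then (x - y) else 1) *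
  (∏ x ∈ X, ∏ y ∈ X, if 0 < x ∧ y < x then
      x ^ (2 * Real.logb q t - 1) * qPochR q (q * t⁻¹ * y * x⁻¹) / qPochR q (t * y * x⁻¹)
    else 1) *
  (∏ x ∈ X, ∏ y ∈ X, if x < 0 ∧ y < x then
      |y| ^ (2 * Real.logb q t - 1) * qPochR q (q * t⁻¹ * x * y⁻¹) / qPochR q (t * x * y⁻¹)
    else 1)

/-- The constant `C_N(k) = ∏_{1≤i<j≤N, i≤k} ψ_τ(ζ₋ζ₊⁻¹ t^{N-i-j+1})`. -/
noncomputable def CNconst (q t ζp ζm : ℝ) (N k : ℕ) : ℝ :=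
  ∏ i ∈ Finset.Icc 1 N, ∏ j ∈ Finset.Icc 1 N,
    if i < j ∧ i ≤ k then psiQ q t (ζm * ζp⁻¹ * t ^ ((N : ℤ) - (i : ℤ) - (j : ℤ) + 1)) else 1

/-- The unnormalized N-particle weight
`M̃_N(X) = C_N(|X⁺|) V_{q,t}(X) ∏_{x∈X} W(x; q; a,b,c,d)`. -/
noncomputable def Mtilde (q t ζp ζm : ℝ) (N : ℕ) (a b c d : ℂ) (X : Finset ℝ) : ℂ :=
  ((CNconst q t ζp ζm N (X.filter (fun x => 0 < x)).card * Vqt q t X : ℝ) : ℂ) *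
    ∏ x ∈ X, Wc q a b c d x

theorem qPochR_multipliable {q : ℝ} (hq0 : 0 < q) (hq1 : q < 1) (u : ℝ) :
    Multipliable fun n : ℕ => 1 - u * q ^ n := by
  have h : Summable fun n : ℕ => -(u * q ^ n) :=
    ((summable_geometric_of_lt_one hq0.le hq1).mul_left u).neg
  simpa [sub_eq_add_neg] using Real.multipliable_one_add_of_summable h

theorem tendsto_qPochR {q : ℝ} (hq0 : 0 < q) (hq1 : q < 1) (u : ℝ) :
    Filter.Tendsto (fun n : ℕ => ∏ i ∈ Finset.range n, (1 - u * q ^ i)) Filter.atTop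
      (nhds (qPochR q u)) :=
  (qPochR_multipliable hq0 hq1 u).hasProd.tendsto_prod_nat

theorem qPochR_pos {q : ℝ} (hq0 : 0 < q) (hq1 : q < 1) {u : ℝ} (hu : u < 1) :
    0 < qPochR q u := by
  have hpos : ∀ n : ℕ, 0 < 1 - u * q ^ n := by
    intro n
    have h1 : 0 < q ^ n := pow_pos hq0 n
    have h2 : q ^ n ≤ 1 := pow_le_one₀ hq0.le hq1.le
    nlinarith
  have h : Summable fun n : ℕ => -(u * q ^ n) :=
    ((summable_geometric_of_lt_one hq0.le hq1).mul_left u).neg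
  have hlog : Summable fun n : ℕ => Real.log (1 - u * q ^ n) := by
    simpa [sub_eq_add_neg] using Real.summable_log_one_add_of_summable h
  rw [qPochR, ← Real.rexp_tsum_eq_tprod hpos hlog]
  exact Real.exp_pos _

theorem qPochR_anti {q : ℝ} (hq0 : 0 < q) (hq1 : q < 1) {u v : ℝ} (huv : u ≤ v) (hv : v ≤ 1) :
    qPochR q v ≤ qPochR q u := by
  refine le_of_tendsto_of_tendsto' (tendsto_qPochR hq0 hq1 v) (tendsto_qPochR hq0 hq1 u) ?_
  intro n
  refine Finset.prod_le_prod (fun i _ => ?_) (fun i _ => ?_)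
  · have h1 : 0 < q ^ i := pow_pos hq0 i
    have h2 : q ^ i ≤ 1 := pow_le_one₀ hq0.le hq1.le
    nlinarith
  · have h1 : 0 < q ^ i := pow_pos hq0 i
    nlinarith

theorem qPochR_zero (q : ℝ) : qPochR q 0 = 1 := by simp [qPochR]

theorem qPochR_eq_mul {q : ℝ} (hq0 : 0 < q) (hq1 : q < 1) (u : ℝ) :
    qPochR q u = (1 - u) * qPochR q (u * q) := by
  have h := tendsto_qPochR hq0 hq1 (u * q)
  have h2 := (tendsto_qPochR hq0 hq1 u).comp (Filter.tendsto_add_atTop_nat 1)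
  refine tendsto_nhds_unique h2 ((h.const_mul (1 - u)).congr fun n => ?_)
  simp only [Function.comp, Finset.prod_range_succ', pow_zero, mul_one]
  rw [mul_comm]
  congr 1
  exact Finset.prod_congr rfl fun i _ => by ring

theorem one_add_rpow_mul_rpow_le {x y r : ℝ} (hx : 0 ≤ x) (hy : 0 ≤ y) (hr0 : 0 ≤ r)
    (hr1 : r ≤ 1) : 1 + x ^ r * y ^ (1 - r) ≤ (1 + x) ^ r * (1 + y) ^ (1 - r) := by
  have hx1 : 0 < 1 + x := by linarith
  have hy1 : 0 < 1 + y := by linarith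
  have h1 := Real.geom_mean_le_arith_mean2_weighted hr0 (sub_nonneg.2 hr1)
    (div_nonneg zero_le_one hx1.le) (div_nonneg zero_le_one hy1.le) (by ring)
  have h2 := Real.geom_mean_le_arith_mean2_weighted hr0 (sub_nonneg.2 hr1)
    (div_nonneg hx hx1.le) (div_nonneg hy hy1.le) (by ring)
  rw [Real.div_rpow zero_le_one hx1.le, Real.div_rpow zero_le_one hy1.le, Real.one_rpow,
    Real.one_rpow] at h1
  rw [Real.div_rpow hx hx1.le, Real.div_rpow hy hy1.le] at h2
  have hA : 0 < (1 + x) ^ r := Real.rpow_pos_of_pos hx1 _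
  have hB : 0 < (1 + y) ^ (1 - r) := Real.rpow_pos_of_pos hy1 _
  have hs : r * (1 / (1 + x)) + (1 - r) * (1 / (1 + y)) + (r * (x / (1 + x)) +
      (1 - r) * (y / (1 + y))) = 1 := by field_simp; ring
  have h3 : (1 + x ^ r * y ^ (1 - r)) / ((1 + x) ^ r * (1 + y) ^ (1 - r)) ≤ 1 := by
    calc _ = 1 / (1 + x) ^ r * (1 / (1 + y) ^ (1 - r)) +
          x ^ r / (1 + x) ^ r * (y ^ (1 - r) / (1 + y) ^ (1 - r)) := by field_simp
      _ ≤ 1 := by linarith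
  exact (div_le_one (mul_pos hA hB)).1 h3

theorem qPochR_neg_logConvex {q : ℝ} (hq0 : 0 < q) (hq1 : q < 1) {x y r : ℝ} (hx : 0 ≤ x)
    (hy : 0 ≤ y) (hr0 : 0 ≤ r) (hr1 : r ≤ 1) :
    qPochR q (-(x ^ r * y ^ (1 - r))) ≤ qPochR q (-x) ^ r * qPochR q (-y) ^ (1 - r) := by
  have hX := (tendsto_qPochR hq0 hq1 (-x)).rpow_const (p := r) (Or.inr hr0)
  have hY := (tendsto_qPochR hq0 hq1 (-y)).rpow_const (p := 1 - r) (Or.inr (by linarith))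
  refine le_of_tendsto_of_tendsto' (tendsto_qPochR hq0 hq1 _) (hX.mul hY) ?_
  intro n
  have hn : ∀ z : ℝ, 0 ≤ z → ∀ i : ℕ, 0 ≤ z * q ^ i := fun z hz i =>
    mul_nonneg hz (pow_pos hq0 i).le
  have hP : ∀ z : ℝ, 0 ≤ z → ∀ i ∈ Finset.range n, 0 ≤ 1 - -z * q ^ i := fun z hz i _ => by
    have := hn z hz i
    linarith
  rw [← Real.finsetProd_rpow _ _ (hP x hx), ← Real.finsetProd_rpow _ _ (hP y hy),
    ← Finset.prod_mul_distrib]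
  refine Finset.prod_le_prod (hP _ (by positivity)) fun i _ => ?_
  have h := one_add_rpow_mul_rpow_le (hn x hx i) (hn y hy i) hr0 hr1
  have hqi : (q ^ i) ^ r * (q ^ i) ^ (1 - r) = q ^ i := by
    rw [← Real.rpow_add (pow_pos hq0 i)]; simp
  rw [Real.mul_rpow hx (pow_pos hq0 i).le, Real.mul_rpow hy (pow_pos hq0 i).le] at h
  calc 1 - -(x ^ r * y ^ (1 - r)) * q ^ i
      = 1 + x ^ r * (q ^ i) ^ r * (y ^ (1 - r) * (q ^ i) ^ (1 - r)) := by
        linear_combination -(x ^ r * y ^ (1 - r)) * hqi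
    _ ≤ _ := h
    _ = _ := by simp [sub_neg_eq_add]

theorem qPochR_neg_div_pow_le {q : ℝ} (hq0 : 0 < q) (hq1 : q < 1) {u w : ℝ} (hu : 0 ≤ u)
    (m : ℕ) (hw : u / q ^ m ≤ w) : qPochR q (-(u / q ^ m)) ≤ (1 + w) ^ m * qPochR q (-u) := by
  induction m with
  | zero => simp
  | succ m ih =>
    have hqm := pow_pos hq0 m
    have hle : u / q ^ m ≤ u / q ^ (m + 1) :=
      div_le_div_of_nonneg_left hu (pow_pos hq0 _)
        (pow_le_pow_of_le_one hq0.le hq1.le (Nat.le_succ m))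
    have ih' := ih (hle.trans hw)
    have h0 : 0 ≤ u / q ^ (m + 1) := by positivity
    have heq : -(u / q ^ (m + 1)) * q = -(u / q ^ m) := by
      rw [pow_succ]; field_simp
    rw [qPochR_eq_mul hq0 hq1, heq, pow_succ' (1 + w), mul_assoc]
    have hpos : 0 < qPochR q (-(u / q ^ m)) :=
      qPochR_pos hq0 hq1 (by linarith [div_nonneg hu hqm.le])
    exact mul_le_mul (by linarith) ih' hpos.le (by linarith)

/-- The growth rate of the ratio `(-v/t; q)_∞ / (-tv; q)_∞` is at most `v ^ (2 log_q t)`. -/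
theorem exists_qPochR_neg_le {q t : ℝ} (hq0 : 0 < q) (hq1 : q < 1) (ht0 : 0 < t) (ht1 : t < 1) :
    ∃ C : ℝ, 0 < C ∧ ∀ v : ℝ, 0 < v → qPochR q (-(t⁻¹ * v)) ≤
      C * (1 + v) ^ (2 * Real.logb q t) * qPochR q (-(t * v)) := by
  set s := 2 * Real.logb q t with hs
  have hs0 : 0 < s := mul_pos two_pos (Real.logb_pos_of_base_lt_one hq0 hq1 ht0 ht1)
  obtain ⟨m, hm⟩ := exists_nat_ge s
  have hm0 : (0 : ℝ) < m := hs0.trans_le hm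
  have hqm := pow_pos hq0 m
  refine ⟨((q ^ m)⁻¹) ^ s, by positivity, fun v hv => ?_⟩
  have hr0 : 0 ≤ s / m := by positivity
  have hr1 : s / m ≤ 1 := (div_le_one hm0).2 hm
  have htv : 0 < t * v := by positivity
  have hqs : q ^ s = t ^ 2 := by
    rw [hs, mul_comm, Real.rpow_mul hq0.le, Real.rpow_logb hq0 hq1.ne ht0]
    norm_num
  have key : (t * v / q ^ m) ^ (s / m) * (t * v) ^ (1 - s / m) = t⁻¹ * v := by
    rw [Real.div_rpow htv.le hqm.le, ← Real.rpow_natCast q m, ← Real.rpow_mul hq0.le,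
      mul_div_cancel₀ _ hm0.ne', hqs, div_mul_eq_mul_div, ← Real.rpow_add htv]
    simp
    field_simp
  have h := qPochR_neg_logConvex hq0 hq1 (x := t * v / q ^ m) (y := t * v) (r := s / m)
    (by positivity) htv.le hr0 hr1
  rw [key] at h
  have hP : 0 < qPochR q (-(t * v)) := qPochR_pos hq0 hq1 (by linarith)
  have hw0 : 0 ≤ t * v / q ^ m := by positivity
  have hb : 1 + t * v / q ^ m ≤ (q ^ m)⁻¹ * (1 + v) := by
    have h1 : 1 ≤ (q ^ m)⁻¹ := (one_le_inv₀ hqm).2 (pow_le_one₀ hq0.le hq1.le)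
    have h2 : t * v / q ^ m ≤ (q ^ m)⁻¹ * v := by
      rw [div_eq_inv_mul]
      exact mul_le_mul_of_nonneg_left (by nlinarith) (by positivity)
    linarith
  calc qPochR q (-(t⁻¹ * v))
      ≤ qPochR q (-(t * v / q ^ m)) ^ (s / m) * qPochR q (-(t * v)) ^ (1 - s / m) := h
    _ ≤ ((1 + t * v / q ^ m) ^ m * qPochR q (-(t * v))) ^ (s / m) *
          qPochR q (-(t * v)) ^ (1 - s / m) := by
        gcongr
        · exact (qPochR_pos hq0 hq1 (by linarith)).le
        · exact qPochR_neg_div_pow_le hq0 hq1 htv.le m le_rfl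
    _ = (1 + t * v / q ^ m) ^ s * qPochR q (-(t * v)) := by
        rw [Real.mul_rpow (by positivity) hP.le, mul_assoc, ← Real.rpow_add hP,
          ← Real.rpow_natCast, ← Real.rpow_mul (by positivity), mul_div_cancel₀ _ hm0.ne']
        simp
    _ ≤ ((q ^ m)⁻¹ * (1 + v)) ^ s * qPochR q (-(t * v)) := by gcongr
    _ = _ := by rw [Real.mul_rpow (by positivity) (by positivity)]

theorem abs_interaction_same_sign_le {q t : ℝ} (s : ℝ) (hq0 : 0 < q) (hq1 : q < 1) (ht0 : 0 < t)
    (ht1 : t < 1) {x y : ℝ} (hx : 0 < x) (hy : 0 < y) (hyx : y ≤ x * t) :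
    |(x - y) * (x ^ (s - 1) * qPochR q (q * t⁻¹ * y * x⁻¹) / qPochR q (t * y * x⁻¹))| ≤
      (qPochR q (t ^ 2))⁻¹ * x ^ s := by
  have ht2 : t ^ 2 < 1 := by nlinarith
  have hu : y * x⁻¹ ≤ t := by
    rw [← div_eq_mul_inv, div_le_iff₀ hx]; linarith
  have hu0 : 0 < y * x⁻¹ := by positivity
  have h1 : t * y * x⁻¹ ≤ t ^ 2 := by nlinarith
  have h2 : q * t⁻¹ * y * x⁻¹ < 1 := by
    have h3 : t⁻¹ * (y * x⁻¹) ≤ 1 := by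
      rw [inv_mul_le_iff₀ ht0]; linarith
    have h4 : 0 < t⁻¹ * (y * x⁻¹) := by positivity
    calc q * t⁻¹ * y * x⁻¹ = q * (t⁻¹ * (y * x⁻¹)) := by ring
      _ < 1 := by nlinarith
  have hnum0 := qPochR_pos hq0 hq1 h2
  have hnum1 : qPochR q (q * t⁻¹ * y * x⁻¹) ≤ 1 :=
    (qPochR_anti hq0 hq1 (by positivity) h2.le).trans (qPochR_zero q).le
  have hP0 := qPochR_pos hq0 hq1 ht2
  have hden : qPochR q (t ^ 2) ≤ qPochR q (t * y * x⁻¹) := qPochR_anti hq0 hq1 h1 ht2.le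
  have hden0 := hP0.trans_le hden
  have hxy : 0 ≤ x - y := by nlinarith
  rw [abs_of_nonneg (by positivity)]
  calc _ ≤ x * (x ^ (s - 1) * 1 / qPochR q (t ^ 2)) := by
        gcongr
        linarith
    _ = (qPochR q (t ^ 2))⁻¹ * x ^ s := by
        rw [Real.rpow_sub_one hx.ne']; field_simp

theorem exists_abs_interaction_opposite_sign_le {q t : ℝ} (hq0 : 0 < q) (hq1 : q < 1)
    (ht0 : 0 < t) (ht1 : t < 1) : ∃ C : ℝ, 0 < C ∧ ∀ x y : ℝ, 0 < x → y < 0 →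
    |(x - y) * (x ^ (2 * Real.logb q t - 1) * qPochR q (q * t⁻¹ * y * x⁻¹) /
      qPochR q (t * y * x⁻¹))| ≤ C * (x - y) ^ (2 * Real.logb q t) := by
  obtain ⟨C, hC, h⟩ := exists_qPochR_neg_le hq0 hq1 ht0 ht1
  refine ⟨C, hC, fun x y hx hy => ?_⟩
  set s := 2 * Real.logb q t
  obtain ⟨v, hv, rfl⟩ : ∃ v, 0 < v ∧ y = -(x * v) :=
    ⟨-y / x, div_pos (neg_pos.2 hy) hx, by field_simp⟩
  have hv' := h v hv
  have e1 : q * t⁻¹ * -(x * v) * x⁻¹ = -(t⁻¹ * v) * q := by field_simp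
  have e2 : t * -(x * v) * x⁻¹ = -(t * v) := by field_simp
  have htv : 0 < t⁻¹ * v := by positivity
  have htv' : 0 < t * v := by positivity
  have hP : 0 < qPochR q (-(t * v)) := qPochR_pos hq0 hq1 (by linarith)
  have hQ : 0 < qPochR q (-(t⁻¹ * v) * q) := qPochR_pos hq0 hq1 (by nlinarith)
  have e3 : x - -(x * v) = x * (1 + v) := by ring
  rw [e1, e2, e3, abs_of_nonneg (by positivity), Real.mul_rpow hx.le (by positivity),
    Real.rpow_sub_one hx.ne']
  rw [qPochR_eq_mul hq0 hq1] at hv'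
  have hvt : v ≤ t⁻¹ * v := le_mul_of_one_le_left hv.le ((one_le_inv₀ ht0).2 ht1.le)
  have hle : (1 + v) * qPochR q (-(t⁻¹ * v) * q) ≤ C * (1 + v) ^ s * qPochR q (-(t * v)) :=
    (mul_le_mul_of_nonneg_right (by linarith) hQ.le).trans hv'
  calc _ = x ^ s * ((1 + v) * qPochR q (-(t⁻¹ * v) * q) / qPochR q (-(t * v))) := by
        field_simp
    _ ≤ x ^ s * (C * (1 + v) ^ s) := by
        gcongr
        exact (div_le_iff₀ hP).2 hle
    _ = _ := by ring

/-- In a configuration, points on the same side of the origin are separated by a factor `t`. -/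
theorem IsConfig.le_mul_of_pos {q t ζp ζm : ℝ} (hq0 : 0 < q) (hq1 : q < 1) (ht0 : 0 < t)
    {X : Finset ℝ} (hX : IsConfig q t ζp ζm X) {x y : ℝ} (hx : x ∈ X) (hy : y ∈ X) (hy0 : 0 < y)
    (hyx : y < x) : y ≤ x * t := by
  obtain ⟨z, hz, hmax⟩ := (X.filter (· < x)).exists_max_image id ⟨y, by simp [hy, hyx]⟩
  simp only [Finset.mem_filter, id, and_imp] at hz hmax
  have hyz := hmax y hy hyx
  obtain ⟨k, hk⟩ := hX.2.2.2.2.2.2.1 x hx z hz.1 (hy0.trans_le hyz) hz.2 fun w hw =>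
    (lt_or_ge w x).imp (hmax w hw) id
  have : x * t * q ^ k ≤ x * t :=
    mul_le_of_le_one_right (mul_pos (hy0.trans hyx) ht0).le (pow_le_one₀ hq0.le hq1.le)
  linarith

theorem IsConfig.mul_le_of_neg {q t ζp ζm : ℝ} (hq0 : 0 < q) (hq1 : q < 1) (ht0 : 0 < t)
    {X : Finset ℝ} (hX : IsConfig q t ζp ζm X) {x y : ℝ} (hx : x ∈ X) (hy : y ∈ X) (hx0 : x < 0)
    (hyx : y < x) : -x ≤ -y * t := by
  obtain ⟨z, hz, hmin⟩ := (X.filter (y < ·)).exists_min_image id ⟨x, by simp [hx, hyx]⟩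
  simp only [Finset.mem_filter, id, and_imp] at hz hmin
  have hzx := hmin x hx hyx
  obtain ⟨k, hk⟩ := hX.2.2.2.2.2.2.2 z hz.1 y hy hz.2 (hzx.trans_lt hx0) fun w hw =>
    (le_or_gt w y).imp id (hmin w hw)
  have : -y * t * q ^ k ≤ -y * t :=
    mul_le_of_le_one_right (mul_pos (by linarith) ht0).le (pow_le_one₀ hq0.le hq1.le)
  linarith

theorem prod_prod_ite_lt_mul (X : Finset ℝ) (M : ℝ → ℝ) :
    ∏ x ∈ X, ∏ y ∈ X, (if y < x then M x * M y else 1) = ∏ x ∈ X, M x ^ (X.card - 1) := by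
  have h1 : ∏ x ∈ X, ∏ y ∈ X, (if y < x then M x * M y else 1) =
      (∏ x ∈ X, ∏ y ∈ X, if y < x then M x else 1) *
        ∏ x ∈ X, ∏ y ∈ X, if x < y then M x else 1 := by
    rw [Finset.prod_comm (f := fun x y => if x < y then M x else 1)]
    simp only [← Finset.prod_mul_distrib]
    refine Finset.prod_congr rfl fun x _ => Finset.prod_congr rfl fun y _ => ?_
    split_ifs <;> simp
  rw [h1, ← Finset.prod_mul_distrib]
  refine Finset.prod_congr rfl fun x hx => ?_
  rw [← Finset.prod_mul_distrib, ← Finset.mul_prod_erase X _ hx,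
    Finset.prod_congr rfl (g := fun _ => M x), Finset.prod_const, Finset.card_erase_of_mem hx]
  · simp
  · intro y hy
    rcases lt_or_gt_of_ne (Finset.ne_of_mem_erase hy) with h | h <;> simp [h, h.not_gt]

/-- The estimate `V_{q,t}(X) ≤ C ∏_{x∈X} max(1,|x|)^{2τ(N-1)}` uniformly over `X ∈ Ω_N`,
where `τ = log_q t`. -/
theorem stmt7 (q t ζp ζm : ℝ) (hq0 : 0 < q) (hq1 : q < 1) (ht0 : 0 < t) (ht1 : t < 1)
    (hζp : 0 < ζp) (hζm : ζm < 0) (N : ℕ) (hN : 1 ≤ N) :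
    ∃ C : ℝ, 0 < C ∧ ∀ X ∈ OmegaN q t ζp ζm N,
      Vqt q t X ≤ C * ∏ x ∈ X, max 1 |x| ^ (2 * Real.logb q t * ((N : ℝ) - 1)) := by
  obtain ⟨A, hA, hopp⟩ := exists_abs_interaction_opposite_sign_le hq0 hq1 ht0 ht1
  have hsame := @abs_interaction_same_sign_le q t (2 * Real.logb q t) hq0 hq1 ht0 ht1
  set s := 2 * Real.logb q t with hs
  have hs0 : 0 < s := mul_pos two_pos (Real.logb_pos_of_base_lt_one hq0 hq1 ht0 ht1)
  set B := (qPochR q (t ^ 2))⁻¹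
  have hB : 0 < B := inv_pos.2 (qPochR_pos hq0 hq1 (by nlinarith))
  set D := 1 + B + A * 2 ^ s with hD
  have hA2 : 0 < A * 2 ^ s := by positivity
  have hD1 : 1 ≤ D := by linarith
  refine ⟨∏ _i ∈ Finset.range N, ∏ _j ∈ Finset.range N, D, by positivity, ?_⟩
  rintro X ⟨hcard, hX⟩
  set M : ℝ → ℝ := fun x => max 1 |x| ^ s with hM
  have hM1 : ∀ x, 1 ≤ M x := fun x => Real.one_le_rpow (le_max_left _ _) hs0.le
  have hMx : ∀ x, |x| ^ s ≤ M x := fun x =>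
    Real.rpow_le_rpow (abs_nonneg _) (le_max_right _ _) hs0.le
  have hfac : Vqt q t X ≤ ∏ x ∈ X, ∏ y ∈ X, D * (if y < x then M x * M y else 1) := by
    rw [Vqt]
    simp only [← Finset.prod_mul_distrib]
    refine (le_abs_self _).trans ?_
    simp only [Finset.abs_prod]
    refine Finset.prod_le_prod (fun x _ => Finset.prod_nonneg fun y _ => abs_nonneg _)
      fun x hx => Finset.prod_le_prod (fun y _ => abs_nonneg _) fun y hy => ?_
    by_cases hyx : y < x
    · rcases lt_trichotomy x 0 with hx0 | rfl | hx0
      · have hy0 : y < 0 := hyx.trans hx0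
        have h := hsame (x := -y) (y := -x) (by linarith) (by linarith)
          (hX.mul_le_of_neg hq0 hq1 ht0 hx hy hx0 hyx)
        have e1 : -y - -x = x - y := by ring
        have e2 : ∀ c : ℝ, c * -x * (-y)⁻¹ = c * x * y⁻¹ := fun c => by
          rw [inv_neg]; ring
        rw [e1, e2, e2, ← abs_of_neg hy0] at h
        simp only [hyx, hx0, hx0.not_gt, if_true, false_and, if_false, and_self, mul_one]
        refine h.trans (mul_le_mul (by linarith) ?_ (by positivity) (by linarith))
        exact (hMx y).trans (le_mul_of_one_le_left (by linarith [hM1 y]) (hM1 x))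
      · exact absurd hx hX.2.1
      · simp only [hyx, hx0, hx0.not_gt, if_true, false_and, if_false, and_self, mul_one]
        rcases lt_trichotomy y 0 with hy0 | rfl | hy0
        · refine (hopp x y hx0 hy0).trans ?_
          have hmx : 1 ≤ max 1 |x| := le_max_left _ _
          have hmy : 1 ≤ max 1 |y| := le_max_left _ _
          have hxm : x ≤ max 1 |x| := (le_abs_self x).trans (le_max_right _ _)
          have hym : -y ≤ max 1 |y| := (neg_le_abs y).trans (le_max_right _ _)
          have hsum : x - y ≤ 2 * (max 1 |x| * max 1 |y|) := by nlinarith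
          calc A * (x - y) ^ s ≤ A * (2 * (max 1 |x| * max 1 |y|)) ^ s := by
                gcongr
            _ = A * 2 ^ s * (M x * M y) := by
                rw [Real.mul_rpow two_pos.le (by positivity),
                  Real.mul_rpow (by positivity) (by positivity)]
                ring
            _ ≤ D * (M x * M y) := by
                gcongr
                linarith
        · exact absurd hy hX.2.1
        · refine (hsame hx0 hy0 (hX.le_mul_of_pos hq0 hq1 ht0 hx hy hy0 hyx)).trans
            (mul_le_mul (by linarith) ?_ (by positivity) (by linarith))
          have := hMx x
          rw [abs_of_pos hx0] at this
          exact this.trans (le_mul_of_one_le_right (by linarith [hM1 x]) (hM1 y))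
    · simpa [hyx] using hD1
  refine hfac.trans_eq ?_
  simp only [Finset.prod_mul_distrib, prod_prod_ite_lt_mul]
  congr 1
  · simp [hcard]
  · refine Finset.prod_congr rfl fun x _ => ?_
    rw [hM, hcard, ← Real.rpow_natCast, ← Real.rpow_mul (by positivity), Nat.cast_sub hN,
      Nat.cast_one]
end
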